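/- Let α > 0 be given and assume the standing hypotheses (H1)–(H3) with constant d ∈ [0,1). Then there exists M(α) > 0 such that for every integer n > 1 + M(α)/(2−2d), the discrete system (Sα) (defined with this n) has exactly one positive solution (u₁,…,u_n) ∈ (0,∞)ⁿ. -/

import Mathlib

noncomputable section

/-- `Useq g1 h k` is the function `U_{k+1}` (0-indexed version of the recursion). -/
def Useq (g1 : ℝ → ℝ) (h : ℝ) : ℕ → ℝ → ℝ
  | 0 => fun x => x
  | 1 => fun x => x + h ^ 2 / 2 * g1 x
  | k + 2 => fun x =>
      2 * Useq g1 h (k + 1) x - Useq g1 h k x + h ^ 2 * g1 (Useq g1 h (k + 1) x)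

/-- `discU g1 h k` is the function `U_k` from the paper, for `1 ≤ k`. -/
def discU (g1 : ℝ → ℝ) (h : ℝ) (k : ℕ) : ℝ → ℝ := Useq g1 h (k - 1)

/-- The function `A(u₁)` from the paper. -/
def discA (g1 g2 : ℝ → ℝ) (h : ℝ) (n : ℕ) (x : ℝ) : ℝ :=
  ((discU g1 h n x - discU g1 h (n - 1) x) / h + h / 2 * g1 (discU g1 h n x)) /
    g2 (discU g1 h n x)

/-- `(u₁, …, u_n)` (encoded as `u : ℕ → ℝ` on indices `1,…,n`) is a positive solution of
the discrete system `(Sα)`. -/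
def IsSolution (g1 g2 : ℝ → ℝ) (n : ℕ) (h α : ℝ) (u : ℕ → ℝ) : Prop :=
  (∀ k, 1 ≤ k → k ≤ n → 0 < u k) ∧
  u 2 - u 1 = h ^ 2 / 2 * g1 (u 1) ∧
  (∀ k, 2 ≤ k → k ≤ n - 1 → u (k + 1) - 2 * u k + u (k - 1) = h ^ 2 * g1 (u k)) ∧
  u n - u (n - 1) = -(h ^ 2 / 2) * g1 (u n) + h * α * g2 (u n)

/-- `G₁`, the primitive of `g₁` vanishing at `0`. -/
def primG1 (g1 : ℝ → ℝ) (x : ℝ) : ℝ := ∫ t in (0:ℝ)..x, g1 t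

/-- `g := g₁/g₂`. -/
def gg (g1 g2 : ℝ → ℝ) (x : ℝ) : ℝ := g1 x / g2 x

/-- `G := G₁/g₂²`. -/
def GG (g1 g2 : ℝ → ℝ) (x : ℝ) : ℝ := primG1 g1 x / (g2 x) ^ 2

/-- The trapezoidal-rule error `E` as a function of `u₁`. -/
def trapError (g1 : ℝ → ℝ) (h : ℝ) (n : ℕ) (x : ℝ) : ℝ :=
  (∑ k ∈ Finset.Icc 1 (n - 1),
    (g1 (discU g1 h k x) + g1 (discU g1 h (k + 1) x)) / 2 *
      (discU g1 h (k + 1) x - discU g1 h k x)) -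
  (primG1 g1 (discU g1 h n x) - primG1 g1 (discU g1 h 1 x))

/-- The Jacobian matrix `J(α,u)` of the system `(Sα)`. -/
def Jmat (g1 g2 : ℝ → ℝ) (n : ℕ) (h α : ℝ) (u : ℕ → ℝ) : Matrix (Fin n) (Fin n) ℝ :=
  Matrix.of fun i j =>
    if i = j then
      (if (i : ℕ) = 0 then 1 + h ^ 2 / 2 * deriv g1 (u 1)
       else if (i : ℕ) = n - 1 then
         1 + h ^ 2 / 2 * deriv g1 (u n) - h * α * deriv g2 (u n)
       else 2 + h ^ 2 * deriv g1 (u ((i : ℕ) + 1)))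
    else if (i : ℕ) + 1 = (j : ℕ) ∨ (j : ℕ) + 1 = (i : ℕ) then -1 else 0

open Set

/-- Trapezoidal upper bound for the increment of a primitive of a function with monotone
derivative on the positive half line. -/
lemma sub_le_trapezoid {F f f' : ℝ → ℝ} (hF : ∀ x > 0, HasDerivAt F (f x) x)
    (hf : ∀ x > 0, HasDerivAt f (f' x) x)
    (hsec : ∀ a b, 0 < a → a ≤ b → f b - f a ≤ f' b * (b - a))
    {a b : ℝ} (ha : 0 < a) (hab : a ≤ b) :
    F b - F a ≤ (f a + f b) / 2 * (b - a) := by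
  have hder : ∀ t > 0, HasDerivAt (fun t => (f a + f t) / 2 * (t - a) - F t)
      (f' t / 2 * (t - a) + (f a + f t) / 2 * 1 - f t) t := fun t ht =>
    ((((hf t ht).const_add (f a)).div_const 2).mul ((hasDerivAt_id t).sub_const a)).sub (hF t ht)
  have hpos : ∀ t ∈ Icc a b, 0 < t := fun t ht => ha.trans_le ht.1
  have hmono : MonotoneOn (fun t => (f a + f t) / 2 * (t - a) - F t) (Icc a b) := by
    refine monotoneOn_of_deriv_nonneg (convex_Icc a b)
      (fun t ht => (hder t (hpos t ht)).continuousAt.continuousWithinAt)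
      (fun t ht => (hder t (hpos t (interior_subset ht))).differentiableAt.differentiableWithinAt)
      fun t ht => ?_
    have ht' := interior_subset ht
    rw [(hder t (hpos t ht')).deriv]
    have := hsec a t ha ht'.1
    linarith
  have := hmono (left_mem_Icc.2 hab) (right_mem_Icc.2 hab) hab
  simp only [sub_self, mul_zero] at this
  linarith

/-- Increments of a function with monotone derivative lie between the tangent increments. -/
lemma tangent_bounds {F f : ℝ → ℝ} (hF : ∀ x > 0, HasDerivAt F (f x) x)
    (hf : MonotoneOn f (Ioi 0)) {a b : ℝ} (ha : 0 < a) (hab : a ≤ b) :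
    f a * (b - a) ≤ F b - F a ∧ F b - F a ≤ f b * (b - a) := by
  rcases hab.eq_or_lt with rfl | hlt
  · simp
  have hpos : ∀ t ∈ Icc a b, 0 < t := fun t ht => ha.trans_le ht.1
  obtain ⟨c, hc, hcF⟩ := exists_hasDerivAt_eq_slope F f hlt
    (fun t ht => (hF t (hpos t ht)).continuousAt.continuousWithinAt)
    (fun t ht => hF t (hpos t (Ioo_subset_Icc_self ht)))
  have hc0 : 0 < c := ha.trans hc.1
  have hba : 0 < b - a := sub_pos.2 hlt
  rw [eq_div_iff hba.ne'] at hcF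
  rw [← hcF]
  exact ⟨mul_le_mul_of_nonneg_right (hf ha hc0 hc.1.le) hba.le,
    mul_le_mul_of_nonneg_right (hf hc0 (ha.trans hlt) hc.2.le) hba.le⟩

/-- The velocity Verlet recursion with step `h` for a particle starting at rest at `x` with acceleration `g`:
pairs of positions and momenta. -/
def verlet (g : ℝ → ℝ) (h x : ℝ) : ℕ → ℝ × ℝ
  | 0 => (x, 0)
  | k + 1 =>
    ((verlet g h x k).1 + h * (verlet g h x k).2 + h ^ 2 / 2 * g (verlet g h x k).1,
      (verlet g h x k).2 + h / 2 * (g (verlet g h x k).1 +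
        g ((verlet g h x k).1 + h * (verlet g h x k).2 + h ^ 2 / 2 * g (verlet g h x k).1)))

/-- The position component of `verlet`. -/
def pos (g : ℝ → ℝ) (h : ℝ) (k : ℕ) (x : ℝ) : ℝ := (verlet g h x k).1

/-- The momentum component of `verlet`. -/
def mom (g : ℝ → ℝ) (h : ℝ) (k : ℕ) (x : ℝ) : ℝ := (verlet g h x k).2

lemma pos_zero (g : ℝ → ℝ) (h x : ℝ) : pos g h 0 x = x := rfl

lemma mom_zero (g : ℝ → ℝ) (h x : ℝ) : mom g h 0 x = 0 := rfl

lemma pos_succ (g : ℝ → ℝ) (h : ℝ) (k : ℕ) (x : ℝ) :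
    pos g h (k + 1) x = pos g h k x + h * mom g h k x + h ^ 2 / 2 * g (pos g h k x) := rfl

lemma mom_succ (g : ℝ → ℝ) (h : ℝ) (k : ℕ) (x : ℝ) :
    mom g h (k + 1) x = mom g h k x + h / 2 * (g (pos g h k x) + g (pos g h (k + 1) x)) := rfl

lemma differentiable_pos_mom {g : ℝ → ℝ} (hg : Differentiable ℝ g) (h : ℝ) (k : ℕ) :
    Differentiable ℝ (pos g h k) ∧ Differentiable ℝ (mom g h k) := by
  induction k with
  | zero => exact ⟨differentiable_id, differentiable_const 0⟩
  | succ k ih =>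
    obtain ⟨h1, h2⟩ := ih
    have h3 : Differentiable ℝ (pos g h (k + 1)) := by
      have : pos g h (k + 1) = fun x =>
        pos g h k x + h * mom g h k x + h ^ 2 / 2 * g (pos g h k x) := rfl
      rw [this]
      fun_prop
    refine ⟨h3, ?_⟩
    have : mom g h (k + 1) = fun x =>
      mom g h k x + h / 2 * (g (pos g h k x) + g (pos g h (k + 1) x)) := rfl
    rw [this]
    fun_prop

lemma deriv_pos_succ {g : ℝ → ℝ} (hg : Differentiable ℝ g) (h : ℝ) (k : ℕ) (x : ℝ) :
    deriv (pos g h (k + 1)) x = deriv (pos g h k) x + h * deriv (mom g h k) x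
      + h ^ 2 / 2 * (deriv g (pos g h k x) * deriv (pos g h k) x) := by
  obtain ⟨h1, h2⟩ := differentiable_pos_mom hg h k
  exact (((h1 x).hasDerivAt.add ((h2 x).hasDerivAt.const_mul h)).add
    (((hg _).hasDerivAt.comp x (h1 x).hasDerivAt).const_mul (h ^ 2 / 2))).deriv

lemma deriv_mom_succ {g : ℝ → ℝ} (hg : Differentiable ℝ g) (h : ℝ) (k : ℕ) (x : ℝ) :
    deriv (mom g h (k + 1)) x = deriv (mom g h k) x
      + h / 2 * (deriv g (pos g h k x) * deriv (pos g h k) x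
        + deriv g (pos g h (k + 1) x) * deriv (pos g h (k + 1)) x) := by
  obtain ⟨h1, h2⟩ := differentiable_pos_mom hg h k
  obtain ⟨h3, -⟩ := differentiable_pos_mom hg h (k + 1)
  exact ((h2 x).hasDerivAt.add ((((hg _).hasDerivAt.comp x (h1 x).hasDerivAt).add
    ((hg _).hasDerivAt.comp x (h3 x).hasDerivAt)).const_mul (h / 2))).deriv

section Verlet

variable {g : ℝ → ℝ} {h x : ℝ}

lemma pos_pos_mom_nonneg (hg : ∀ y > 0, 0 < g y) (hh : 0 < h) (hx : 0 < x) (k : ℕ) :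
    0 < pos g h k x ∧ 0 ≤ mom g h k x := by
  induction k with
  | zero => exact ⟨hx, le_rfl⟩
  | succ k ih =>
    obtain ⟨h1, h2⟩ := ih
    have h3 := hg _ h1
    have h4 : 0 < pos g h (k + 1) x := by rw [pos_succ]; positivity
    have h5 := hg _ h4
    exact ⟨h4, by rw [mom_succ]; positivity⟩

lemma pos_le_pos_succ (hg : ∀ y > 0, 0 < g y) (hh : 0 < h) (hx : 0 < x) (k : ℕ) :
    pos g h k x ≤ pos g h (k + 1) x := by
  obtain ⟨h1, h2⟩ := pos_pos_mom_nonneg hg hh hx k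
  have h3 := hg _ h1
  have : 0 ≤ h * mom g h k x + h ^ 2 / 2 * g (pos g h k x) := by positivity
  rw [pos_succ]
  linarith

lemma pos_monotone (hg : ∀ y > 0, 0 < g y) (hh : 0 < h) (hx : 0 < x) :
    Monotone fun k => pos g h k x :=
  monotone_nat_of_le_succ (pos_le_pos_succ hg hh hx)

lemma mom_bounds (hg : ∀ y > 0, 0 < g y) (hm : MonotoneOn g (Ioi 0)) (hh : 0 < h) (hx : 0 < x)
    (k : ℕ) : h * k * g x ≤ mom g h k x ∧ mom g h k x ≤ h * k * g (pos g h k x) := by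
  induction k with
  | zero => simp [mom_zero]
  | succ k ih =>
    have hp := (pos_pos_mom_nonneg hg hh hx k).1
    have hp' := (pos_pos_mom_nonneg hg hh hx (k + 1)).1
    have h1 : g x ≤ g (pos g h k x) := hm hx hp (pos_monotone hg hh hx (Nat.zero_le k))
    have h2 : g (pos g h k x) ≤ g (pos g h (k + 1) x) :=
      hm hp hp' (pos_le_pos_succ hg hh hx k)
    rw [mom_succ]
    push_cast
    have h3 : h * (g x) ≤ h * g (pos g h k x) := by gcongr
    have h4 : h * g (pos g h k x) ≤ h * g (pos g h (k + 1) x) := by gcongr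
    have h5 : (k : ℝ) * (h * g (pos g h k x)) ≤ k * (h * g (pos g h (k + 1) x)) := by gcongr
    constructor <;> linarith [ih.1, ih.2]

lemma energy_lower {G : ℝ → ℝ} (hg : ∀ y > 0, 0 < g y) (hm : MonotoneOn g (Ioi 0))
    (htrap : ∀ a b, 0 < a → a ≤ b → G b - G a ≤ (g a + g b) / 2 * (b - a))
    (hh : 0 < h) (hx : 0 < x) (k : ℕ) :
    2 * (G (pos g h k x) - G x) ≤ mom g h k x ^ 2 := by
  induction k with
  | zero => simp [mom_zero, pos_zero]
  | succ k ih =>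
    have hp := (pos_pos_mom_nonneg hg hh hx k).1
    have hp' := (pos_pos_mom_nonneg hg hh hx (k + 1)).1
    have hle := pos_le_pos_succ hg hh hx k
    have h1 := htrap _ _ hp hle
    have h2 := hm hp hp' hle
    have h3 := hg _ hp
    have hb := pos_succ g h k x
    rw [mom_succ]
    generalize pos g h (k + 1) x = b at *
    generalize pos g h k x = a at *
    generalize mom g h k x = P at *
    have hsq : h ^ 2 / 4 * (g a ^ 2) ≤ h ^ 2 / 4 * (g b ^ 2) := by gcongr
    have hid : (P + h / 2 * (g a + g b)) ^ 2 - P ^ 2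
        = (g a + g b) * (b - a) + (h ^ 2 / 4 * (g b ^ 2) - h ^ 2 / 4 * (g a ^ 2)) := by
      rw [hb]; ring
    linarith

lemma energy_upper {G : ℝ → ℝ} (hg : ∀ y > 0, 0 < g y) (hm : MonotoneOn g (Ioi 0))
    (htan : ∀ a b, 0 < a → a ≤ b → g a * (b - a) ≤ G b - G a)
    (hh : 0 < h) (hx : 0 < x) {n : ℕ} (hn : h * n ≤ 1) {k : ℕ} (hk : k ≤ n) :
    mom g h k x ^ 2 ≤ 2 * (G (pos g h k x) - G x)
      + h * g (pos g h n x) * (g (pos g h k x) - g x)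
      + h ^ 2 / 4 * (g (pos g h k x) ^ 2 - g x ^ 2) := by
  induction k with
  | zero => simp [mom_zero, pos_zero]
  | succ k ih =>
    have ih := ih (by lia)
    have hp := (pos_pos_mom_nonneg hg hh hx k).1
    have hp' := (pos_pos_mom_nonneg hg hh hx (k + 1)).1
    have hpn := (pos_pos_mom_nonneg hg hh hx n).1
    have hle := pos_le_pos_succ hg hh hx k
    have h1 := htan _ _ hp hle
    have h2 := hm hp hp' hle
    have h3 := hg _ hp
    have hb := pos_succ g h k x
    have hmb := (mom_bounds hg hm hh hx k).2
    have hgn : g (pos g h k x) ≤ g (pos g h n x) :=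
      hm hp hpn (pos_monotone hg hh hx (by lia))
    have hkn : h * (k + 1) ≤ 1 := by
      refine le_trans ?_ hn
      have : ((k : ℝ) + 1) ≤ n := by exact_mod_cast hk
      gcongr
    rw [mom_succ]
    generalize pos g h (k + 1) x = b at *
    generalize pos g h k x = a at *
    generalize mom g h k x = P at *
    generalize g (pos g h n x) = Γ at *
    have hstep : b - a ≤ h * Γ := by
      have : P + h / 2 * g a ≤ Γ := by
        nlinarith [mul_le_mul_of_nonneg_right hkn h3.le, mul_pos hh h3]
      have := mul_le_mul_of_nonneg_left this hh.le
      rw [hb]; linarith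
    have hprod : (g b - g a) * (b - a) ≤ (g b - g a) * (h * Γ) :=
      mul_le_mul_of_nonneg_left hstep (sub_nonneg.2 h2)
    have hid : (P + h / 2 * (g a + g b)) ^ 2 - P ^ 2
        = (g a + g b) * (b - a) + h ^ 2 / 4 * (g b ^ 2 - g a ^ 2) := by
      rw [hb]; ring
    linarith

lemma deriv_pos_mom_bounds (hd : Differentiable ℝ g) (hg : ∀ y > 0, 0 < g y)
    (hg' : ∀ y > 0, 0 < deriv g y) (hh : 0 < h) (hx : 0 < x) (k : ℕ) :
    1 ≤ deriv (pos g h k) x ∧ 0 ≤ deriv (mom g h k) x := by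
  induction k with
  | zero =>
    have h1 : pos g h 0 = id := rfl
    have h2 : mom g h 0 = fun _ => 0 := rfl
    simp [h1, h2]
  | succ k ih =>
    obtain ⟨h1, h2⟩ := ih
    have h3 := hg' _ (pos_pos_mom_nonneg hg hh hx k).1
    have h4 : 1 ≤ deriv (pos g h (k + 1)) x := by
      rw [deriv_pos_succ hd]
      have : 0 ≤ h * deriv (mom g h k) x
        + h ^ 2 / 2 * (deriv g (pos g h k x) * deriv (pos g h k) x) := by positivity
      linarith
    have h5 := hg' _ (pos_pos_mom_nonneg hg hh hx (k + 1)).1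
    exact ⟨h4, by rw [deriv_mom_succ hd]; positivity⟩

/-- One-sided discrete Wronskian identity. -/
lemma wronskian_le (hd : Differentiable ℝ g) (hg : ∀ y > 0, 0 < g y)
    (hg' : ∀ y > 0, 0 < deriv g y) (hm : MonotoneOn g (Ioi 0))
    (hm' : MonotoneOn (deriv g) (Ioi 0))
    (htrap : ∀ a b, 0 < a → a ≤ b → g b - g a ≤ (deriv g a + deriv g b) / 2 * (b - a))
    (hsec : ∀ a b, 0 < a → a ≤ b → g b - g a ≤ deriv g b * (b - a))
    (hh : 0 < h) (hx : 0 < x) (k : ℕ) :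
    g (pos g h k x) * deriv (pos g h k) x - g x ≤ mom g h k x * deriv (mom g h k) x := by
  induction k with
  | zero =>
    have h1 : pos g h 0 = id := rfl
    simp [mom_zero, h1]
  | succ k ih =>
    have hp := (pos_pos_mom_nonneg hg hh hx k).1
    have hp' := (pos_pos_mom_nonneg hg hh hx (k + 1)).1
    have hle := pos_le_pos_succ hg hh hx k
    have h1 := htrap _ _ hp hle
    have h2 := hsec _ _ hp hle
    have hgm := hm hp hp' hle
    have hgm' := hm' hp hp' hle
    have hga := hg _ hp
    have hga' := hg' _ hp
    have hb := pos_succ g h k x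
    have hβ := deriv_pos_succ hd h k x
    obtain ⟨hv, hq⟩ := deriv_pos_mom_bounds hd hg hg' hh hx k
    rw [mom_succ, deriv_mom_succ hd]
    generalize deriv (pos g h (k + 1)) x = v' at *
    generalize deriv (pos g h k) x = v at *
    generalize deriv (mom g h k) x = p at *
    generalize pos g h (k + 1) x = b at *
    generalize pos g h k x = a at *
    generalize mom g h k x = P at *
    have hvv : v ≤ v' := by
      have : 0 ≤ h * p + h ^ 2 / 2 * (deriv g a * v) := by positivity
      linarith
    have hid : (P + h / 2 * (g a + g b)) * (p + h / 2 * (deriv g a * v + deriv g b * v')) - P * p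
        - (g b * v' - g a * v)
        = v * ((deriv g a + deriv g b) / 2 * (b - a) - (g b - g a))
          + (v' - v) / 2 * (deriv g b * (b - a) - (g b - g a))
          + h ^ 2 / 4 * (g b * deriv g b * v' - g a * deriv g a * v) := by
      rw [show (v' - v) / 2 * (deriv g b * (b - a) - (g b - g a))
        = v' / 2 * (deriv g b * (b - a)) - v / 2 * (deriv g b * (b - a))
          + (v' - v) / 2 * (g b + g a) - (v' - v) * g b by ring]
      generalize g b = B at *
      generalize deriv g b = B' at *
      subst hβ hb
      ring
    have e1 : 0 ≤ v * ((deriv g a + deriv g b) / 2 * (b - a) - (g b - g a)) :=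
      mul_nonneg (by linarith) (by linarith)
    have e2 : 0 ≤ (v' - v) / 2 * (deriv g b * (b - a) - (g b - g a)) :=
      mul_nonneg (by linarith) (by linarith)
    have e3 : g a * deriv g a * v ≤ g b * deriv g b * v' := by
      have hgb := hga.trans_le hgm
      have hgb' := hga'.trans_le hgm'
      gcongr
    have e4 : 0 ≤ h ^ 2 / 4 * (g b * deriv g b * v' - g a * deriv g a * v) :=
      mul_nonneg (by positivity) (by linarith)
    linarith

lemma mul_mom_le_deriv_mom (hd : Differentiable ℝ g) (hg : ∀ y > 0, 0 < g y)
    (hg' : ∀ y > 0, 0 < deriv g y) (hm' : MonotoneOn (deriv g) (Ioi 0))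
    (hsec : ∀ a b, 0 < a → a ≤ b → g b - g a ≤ deriv g b * (b - a))
    (hh : 0 < h) (hx : 0 < x) {c : ℝ} (hc : 0 ≤ c) (hcx : c * g x ≤ deriv g x) (k : ℕ) :
    c * mom g h k x ≤ deriv (mom g h k) x ∧
      c * g (pos g h k x) ≤ deriv g (pos g h k x) * deriv (pos g h k) x := by
  induction k with
  | zero =>
    have h1 : pos g h 0 = id := rfl
    have h2 : mom g h 0 = fun _ => 0 := rfl
    simpa [h1, h2] using hcx
  | succ k ih =>
    obtain ⟨ih1, ih2⟩ := ih
    have hp := (pos_pos_mom_nonneg hg hh hx k).1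
    have hp' := (pos_pos_mom_nonneg hg hh hx (k + 1)).1
    have hle := pos_le_pos_succ hg hh hx k
    have h2 := hsec _ _ hp hle
    have hgm' := hm' hp hp' hle
    have hga' := hg' _ hp
    have hgb' := hg' _ hp'
    have hb := pos_succ g h k x
    have hβ := deriv_pos_succ hd h k x
    obtain ⟨hv, hq⟩ := deriv_pos_mom_bounds hd hg hg' hh hx k
    rw [mom_succ, deriv_mom_succ hd]
    generalize deriv (pos g h (k + 1)) x = v' at *
    generalize deriv (pos g h k) x = v at *
    generalize deriv (mom g h k) x = p at *
    generalize pos g h (k + 1) x = b at *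
    generalize pos g h k x = a at *
    generalize mom g h k x = P at *
    have hinc : c * (b - a) ≤ v' - v := by
      have e1 : h * (c * P) ≤ h * p := by gcongr
      have e2 : h ^ 2 / 2 * (c * g a) ≤ h ^ 2 / 2 * (deriv g a * v) := by gcongr
      rw [hb, hβ]; linarith
    have hnew : c * g b ≤ deriv g b * v' := by
      have e1 := mul_le_mul_of_nonneg_left h2 hc
      have e2 := mul_le_mul_of_nonneg_left hinc hgb'.le
      have e3 := mul_le_mul_of_nonneg_right hgm' (zero_le_one.trans hv)
      linarith
    refine ⟨?_, hnew⟩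
    have := mul_le_mul_of_nonneg_left (add_le_add ih2 hnew) (half_pos hh).le
    linarith

end Verlet

section Primitive

variable {g : ℝ → ℝ}

lemma hasDerivAt_primG1 (hg : Continuous g) (x : ℝ) : HasDerivAt (primG1 g) (g x) x :=
  intervalIntegral.integral_hasDerivAt_right (hg.intervalIntegrable _ _)
    (hg.stronglyMeasurableAtFilter _ _) hg.continuousAt

lemma primG1_zero : primG1 g 0 = 0 := by simp [primG1]

lemma monotoneOn_Ici_of_hasDerivAt {f f' : ℝ → ℝ} (hf : ∀ x, HasDerivAt f (f' x) x)
    (hf' : ∀ x > 0, 0 ≤ f' x) : MonotoneOn f (Ici 0) := by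
  refine monotoneOn_of_deriv_nonneg (convex_Ici 0)
    (fun x _ => (hf x).continuousAt.continuousWithinAt)
    (fun x _ => (hf x).differentiableAt.differentiableWithinAt) fun x hx => ?_
  rw [interior_Ici] at hx
  rw [(hf x).deriv]
  exact hf' x hx

lemma pos_of_deriv_pos (hd : Differentiable ℝ g) (h0 : g 0 = 0) (hg' : ∀ x > 0, 0 < deriv g x)
    {x : ℝ} (hx : 0 < x) : 0 < g x := by
  have hs : StrictMonoOn g (Ici 0) := by
    refine strictMonoOn_of_deriv_pos (convex_Ici 0) hd.continuous.continuousOn fun y hy => ?_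
    rw [interior_Ici] at hy
    exact hg' y hy
  simpa [h0] using hs (mem_Ici.2 le_rfl) (mem_Ici.2 hx.le) hx

lemma primG1_pos (hg : Continuous g) (hpos : ∀ x > 0, 0 < g x) {x : ℝ} (hx : 0 < x) :
    0 < primG1 g x := by
  have hD : deriv (primG1 g) = g := funext fun y => (hasDerivAt_primG1 hg y).deriv
  refine pos_of_deriv_pos (fun y => (hasDerivAt_primG1 hg y).differentiableAt) primG1_zero ?_ hx
  rwa [hD]

lemma primG1_le_mul (hg : Continuous g) (hm : MonotoneOn g (Ici 0)) {x : ℝ} (hx : 0 < x) :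
    primG1 g x ≤ x * g x := by
  obtain ⟨c, hc, hcF⟩ := exists_hasDerivAt_eq_slope (primG1 g) g hx
    (fun t _ => (hasDerivAt_primG1 hg t).continuousAt.continuousWithinAt)
    (fun t _ => hasDerivAt_primG1 hg t)
  rw [primG1_zero, sub_zero, sub_zero, eq_div_iff hx.ne'] at hcF
  rw [← hcF, mul_comm]
  exact mul_le_mul_of_nonneg_left (hm hc.1.le hx.le hc.2.le) hx.le

lemma sq_le_two_mul_primG1_mul_deriv (hd : Differentiable ℝ g) (hd' : Differentiable ℝ (deriv g))
    (h0 : g 0 = 0) (hpos : ∀ x > 0, 0 < g x) (hg'' : ∀ x > 0, 0 < deriv (deriv g) x)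
    {x : ℝ} (hx : 0 < x) : g x ^ 2 ≤ 2 * primG1 g x * deriv g x := by
  have hder : ∀ y, HasDerivAt (fun y => 2 * primG1 g y * deriv g y - g y ^ 2)
      (2 * primG1 g y * deriv (deriv g) y) y := fun y => by
    have := ((((hasDerivAt_primG1 hd.continuous y).const_mul 2).mul (hd' y).hasDerivAt).sub
      ((hd y).hasDerivAt.pow 2))
    refine this.congr_deriv ?_
    simp only [Nat.cast_ofNat]
    ring
  have hm := monotoneOn_Ici_of_hasDerivAt hder fun y hy => by
    have := primG1_pos hd.continuous hpos hy
    have := hg'' y hy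
    positivity
  have := hm (mem_Ici.2 le_rfl) (mem_Ici.2 hx.le) hx.le
  simp only [primG1_zero, h0] at this
  linarith

/-- Convex functions vanishing at the origin grow at least linearly. -/
lemma mul_le_mul_of_deriv_mono (hd : Differentiable ℝ g) (h0 : g 0 = 0)
    (hm : MonotoneOn (deriv g) (Ioi 0)) {c u : ℝ} (hc : 0 < c) (hcu : c ≤ u) :
    u * g c ≤ c * g u := by
  have h1 := (tangent_bounds (fun x _ => (hd x).hasDerivAt) hm hc hcu).1
  obtain ⟨t, ht, htF⟩ := exists_hasDerivAt_eq_slope g (deriv g) hc hd.continuous.continuousOn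
    (fun t _ => (hd t).hasDerivAt)
  rw [h0, sub_zero, sub_zero, eq_div_iff hc.ne'] at htF
  have h2 : deriv g t ≤ deriv g c := hm ht.1 hc ht.2.le
  have h3 : (u - c) * g c ≤ (u - c) * (deriv g c * c) := by
    rw [← htF]
    have : 0 ≤ u - c := sub_nonneg.2 hcu
    gcongr
  have h4 := mul_le_mul_of_nonneg_left h1 hc.le
  linarith

end Primitive

/-- The functions to which the shooting analysis applies: smooth, vanishing at the origin, with
positive first and second and nonnegative third derivative on the positive half line. -/
structure IsConvexSource (g : ℝ → ℝ) : Prop where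
  contDiff : ContDiff ℝ 3 g
  map_zero : g 0 = 0
  deriv_pos : ∀ x > 0, 0 < deriv g x
  deriv_deriv_pos : ∀ x > 0, 0 < deriv (deriv g) x
  deriv_deriv_deriv_nonneg : ∀ x > 0, 0 ≤ deriv (deriv (deriv g)) x

namespace IsConvexSource

variable {g : ℝ → ℝ}

lemma differentiable (hg : IsConvexSource g) : Differentiable ℝ g :=
  hg.contDiff.differentiable (by norm_num)

lemma contDiff_deriv (hg : IsConvexSource g) : ContDiff ℝ 2 (deriv g) :=
  (contDiff_succ_iff_deriv (n := 2).1 hg.contDiff).2.2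

lemma contDiff_deriv_deriv (hg : IsConvexSource g) : ContDiff ℝ 1 (deriv (deriv g)) :=
  (contDiff_succ_iff_deriv (n := 1).1 hg.contDiff_deriv).2.2

lemma differentiable_deriv (hg : IsConvexSource g) : Differentiable ℝ (deriv g) :=
  hg.contDiff_deriv.differentiable (by norm_num)

lemma map_pos (hg : IsConvexSource g) : ∀ x > 0, 0 < g x := fun _ hx =>
  pos_of_deriv_pos hg.differentiable hg.map_zero hg.deriv_pos hx

lemma monotoneOn_Ici (hg : IsConvexSource g) : MonotoneOn g (Ici 0) :=
  monotoneOn_Ici_of_hasDerivAt (fun x => (hg.differentiable x).hasDerivAt)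
    fun x hx => (hg.deriv_pos x hx).le

lemma monotoneOn (hg : IsConvexSource g) : MonotoneOn g (Ioi 0) :=
  hg.monotoneOn_Ici.mono Ioi_subset_Ici_self

lemma monotoneOn_deriv (hg : IsConvexSource g) : MonotoneOn (deriv g) (Ioi 0) :=
  (monotoneOn_Ici_of_hasDerivAt (fun x => (hg.differentiable_deriv x).hasDerivAt)
    fun x hx => (hg.deriv_deriv_pos x hx).le).mono Ioi_subset_Ici_self

lemma monotoneOn_deriv_deriv (hg : IsConvexSource g) : MonotoneOn (deriv (deriv g)) (Ioi 0) :=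
  (monotoneOn_Ici_of_hasDerivAt
    (fun x => (hg.contDiff_deriv_deriv.differentiable (by norm_num) x).hasDerivAt)
    fun x hx => hg.deriv_deriv_deriv_nonneg x hx).mono Ioi_subset_Ici_self

lemma sub_le_deriv_mul (hg : IsConvexSource g) (a b : ℝ) (ha : 0 < a) (hab : a ≤ b) :
    g b - g a ≤ deriv g b * (b - a) :=
  (tangent_bounds (fun x _ => (hg.differentiable x).hasDerivAt) hg.monotoneOn_deriv ha hab).2

lemma sub_le_trapezoid_deriv (hg : IsConvexSource g) (a b : ℝ) (ha : 0 < a) (hab : a ≤ b) :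
    g b - g a ≤ (deriv g a + deriv g b) / 2 * (b - a) :=
  sub_le_trapezoid (fun x _ => (hg.differentiable x).hasDerivAt)
    (fun x _ => (hg.differentiable_deriv x).hasDerivAt)
    (fun _ _ ha hab => (tangent_bounds (fun x _ => (hg.differentiable_deriv x).hasDerivAt)
      hg.monotoneOn_deriv_deriv ha hab).2) ha hab

lemma hasDerivAt_primG1 (hg : IsConvexSource g) (x : ℝ) : HasDerivAt (primG1 g) (g x) x :=
  _root_.hasDerivAt_primG1 hg.differentiable.continuous x

lemma primG1_sub_le (hg : IsConvexSource g) (a b : ℝ) (ha : 0 < a) (hab : a ≤ b) :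
    primG1 g b - primG1 g a ≤ (g a + g b) / 2 * (b - a) :=
  sub_le_trapezoid (fun x _ => hg.hasDerivAt_primG1 x)
    (fun x _ => (hg.differentiable x).hasDerivAt) hg.sub_le_deriv_mul ha hab

lemma le_primG1_sub (hg : IsConvexSource g) (a b : ℝ) (ha : 0 < a) (hab : a ≤ b) :
    g a * (b - a) ≤ primG1 g b - primG1 g a :=
  (tangent_bounds (fun x _ => hg.hasDerivAt_primG1 x) hg.monotoneOn ha hab).1

lemma primG1_pos (hg : IsConvexSource g) {x : ℝ} (hx : 0 < x) : 0 < primG1 g x :=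
  _root_.primG1_pos hg.differentiable.continuous hg.map_pos hx

lemma primG1_le_primG1 (hg : IsConvexSource g) {a b : ℝ} (ha : 0 < a) (hab : a ≤ b) :
    primG1 g a ≤ primG1 g b := by
  have := hg.le_primG1_sub a b ha hab
  have := mul_nonneg (hg.map_pos a ha).le (sub_nonneg.2 hab)
  linarith

variable {h x : ℝ}

lemma mom_sq_le (hg : IsConvexSource g) (hh : 0 < h) (hx : 0 < x) {m : ℕ} (hm : 0 < m)
    (hhm : h * m = 1) :
    mom g h m x ^ 2 ≤ 2 * (primG1 g (pos g h m x) - primG1 g x)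
      + 2 * h * g (pos g h m x) ^ 2 := by
  have h1 := energy_upper hg.map_pos hg.monotoneOn hg.le_primG1_sub hh hx hhm.le le_rfl
  have hgx := hg.map_pos x hx
  have hgu := hg.map_pos _ (pos_pos_mom_nonneg hg.map_pos hh hx m).1
  have hh1 : h ≤ 1 := by
    have : (1 : ℝ) ≤ m := by exact_mod_cast hm
    nlinarith
  generalize g (pos g h m x) = b at *
  have e1 : h * b * (b - g x) ≤ h * b * b := by gcongr; linarith
  have e2 : h ^ 2 / 4 * (b ^ 2 - g x ^ 2) ≤ h * b ^ 2 := by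
    have e3 : h ^ 2 / 4 ≤ h := by nlinarith
    have e4 : b ^ 2 - g x ^ 2 ≤ b ^ 2 := by linarith [sq_nonneg (g x)]
    calc _ ≤ h ^ 2 / 4 * b ^ 2 := by gcongr
      _ ≤ _ := by gcongr
  linarith

lemma deriv_pos_mul_mom_le (hg : IsConvexSource g) (hh : 0 < h) (hx : 0 < x) {m : ℕ} {ε : ℝ}
    (hε : mom g h m x ^ 2 ≤ 2 * (primG1 g (pos g h m x) - primG1 g x) + ε) :
    deriv (pos g h m) x * g (pos g h m x) * mom g h m x
      ≤ deriv (mom g h m) x * (2 * primG1 g (pos g h m x) + ε) := by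
  have hw := wronskian_le hg.differentiable hg.map_pos hg.deriv_pos hg.monotoneOn
    hg.monotoneOn_deriv hg.sub_le_trapezoid_deriv hg.sub_le_deriv_mul hh hx m
  have hGx := hg.primG1_pos hx
  have hgx := hg.map_pos x hx
  have hsq := sq_le_two_mul_primG1_mul_deriv hg.differentiable hg.differentiable_deriv
    hg.map_zero hg.map_pos hg.deriv_deriv_pos hx
  have hc := (mul_mom_le_deriv_mom hg.differentiable hg.map_pos hg.deriv_pos hg.monotoneOn_deriv
    hg.sub_le_deriv_mul hh hx (c := g x / (2 * primG1 g x)) (by positivity)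
    (by rw [div_mul_eq_mul_div, div_le_iff₀ (by positivity)]; linarith) m).1
  rw [div_mul_eq_mul_div, div_le_iff₀ (by positivity)] at hc
  have hP := (pos_pos_mom_nonneg hg.map_pos hh hx m).2
  have hp := (deriv_pos_mom_bounds hg.differentiable hg.map_pos hg.deriv_pos hh hx m).2
  have e1 := mul_le_mul_of_nonneg_right hw hP
  have e2 := mul_le_mul_of_nonneg_left hε hp
  linarith

lemma mom_pos (hg : IsConvexSource g) (hh : 0 < h) (hx : 0 < x) {m : ℕ} (hm : 0 < m) :
    0 < mom g h m x := by
  have hle := (mom_bounds hg.map_pos hg.monotoneOn hh hx m).1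
  have hgx := hg.map_pos x hx
  have hm0 : (0 : ℝ) < m := by exact_mod_cast hm
  exact lt_of_lt_of_le (mul_pos (mul_pos hh hm0) hgx) hle

lemma deriv_mom_pos (hg : IsConvexSource g) (hh : 0 < h) (hx : 0 < x) {m : ℕ} (hm : 0 < m) :
    0 < deriv (mom g h m) x := by
  refine (deriv_pos_mom_bounds hg.differentiable hg.map_pos hg.deriv_pos hh hx m).2.lt_of_ne ?_
  intro h0
  have h1 := deriv_pos_mul_mom_le hg hh hx (m := m)
    (ε := mom g h m x ^ 2 - 2 * (primG1 g (pos g h m x) - primG1 g x)) (by linarith)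
  rw [← h0, zero_mul] at h1
  have h2 := hg.mom_pos hh hx hm
  have h3 := hg.map_pos _ (pos_pos_mom_nonneg hg.map_pos hh hx m).1
  have h4 := (deriv_pos_mom_bounds hg.differentiable hg.map_pos hg.deriv_pos hh hx m).1
  have : 0 < deriv (pos g h m) x := by linarith
  have : 0 < deriv (pos g h m) x * g (pos g h m x) * mom g h m x := by positivity
  linarith

lemma strictMonoOn_pos (hg : IsConvexSource g) (hh : 0 < h) (m : ℕ) :
    StrictMonoOn (pos g h m) (Ioi 0) := by
  refine strictMonoOn_of_deriv_pos (convex_Ioi 0)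
    (differentiable_pos_mom hg.differentiable h m).1.continuous.continuousOn fun y hy => ?_
  rw [interior_Ioi] at hy
  have := (deriv_pos_mom_bounds hg.differentiable hg.map_pos hg.deriv_pos hh hy m).1
  linarith

lemma exists_pos_eq (hg : IsConvexSource g) (hh : 0 < h) (m : ℕ) {c : ℝ} (hc : 0 < c) :
    ∃ x > 0, pos g h m x = c := by
  have h0 : ∀ k, pos g h k 0 = 0 ∧ mom g h k 0 = 0 := fun k => by
    induction k with
    | zero => simp [pos_zero, mom_zero]
    | succ k ih => simp [mom_succ, pos_succ, ih.1, ih.2, hg.map_zero]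
  have hcc : c ≤ pos g h m c := pos_monotone hg.map_pos hh hc (Nat.zero_le m)
  obtain ⟨x, hx, hxc⟩ := intermediate_value_Icc hc.le
    (differentiable_pos_mom hg.differentiable h m).1.continuous.continuousOn
    ⟨(h0 m).1.trans_le hc.le, hcc⟩
  refine ⟨x, hx.1.lt_of_ne ?_, hxc⟩
  rintro rfl
  exact hc.ne' (hxc.symm.trans (h0 m).1)

end IsConvexSource

/-- The shooting quotient of final momentum by boundary flux is strictly increasing where the discretisation
error is small. -/
lemma strictMonoOn_quotient {g1 g2 : ℝ → ℝ} (hg1 : IsConvexSource g1) (hg2 : IsConvexSource g2)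
    {d : ℝ} (hd0 : 0 ≤ d)
    (hH2 : ∀ x > (0 : ℝ), 0 ≤ d * g1 x / primG1 g1 x - 2 * deriv g2 x / g2 x)
    {h : ℝ} (hh : 0 < h) {m : ℕ} (hm : 0 < m) (hhm : h * m = 1) {x y : ℝ} (hx : 0 < x)
    (hsmall : d * (2 * h * g1 (pos g1 h m y) ^ 2) < (2 - 2 * d) * primG1 g1 (pos g1 h m x)) :
    StrictMonoOn (fun t => mom g1 h m t / g2 (pos g1 h m t)) (Icc x y) := by
  obtain ⟨hdu, hdp⟩ := differentiable_pos_mom hg1.differentiable h m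
  have hder : ∀ t > 0, HasDerivAt (fun t => mom g1 h m t / g2 (pos g1 h m t))
      ((deriv (mom g1 h m) t * g2 (pos g1 h m t) - mom g1 h m t *
        (deriv g2 (pos g1 h m t) * deriv (pos g1 h m) t)) / g2 (pos g1 h m t) ^ 2) t :=
    fun t ht => (hdp t).hasDerivAt.div
      ((hg2.differentiable _).hasDerivAt.comp t (hdu t).hasDerivAt)
      (hg2.map_pos _ (pos_pos_mom_nonneg hg1.map_pos hh ht m).1).ne'
  have hpos : ∀ t ∈ Icc x y, 0 < t := fun t ht => hx.trans_le ht.1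
  refine strictMonoOn_of_deriv_pos (convex_Icc x y)
    (fun t ht => (hder t (hpos t ht)).continuousAt.continuousWithinAt) fun t ht => ?_
  have ht := interior_subset ht
  have ht0 := hpos t ht
  rw [(hder t ht0).deriv]
  have hu0 := (pos_pos_mom_nonneg hg1.map_pos hh ht0 m).1
  have hmono := (hg1.strictMonoOn_pos hh m).monotoneOn
  have hxu := hmono hx ht0 ht.1
  have huy := hmono ht0 (ht0.trans_le ht.2) ht.2
  have hx0 := (pos_pos_mom_nonneg hg1.map_pos hh hx m).1
  have hG := hg1.primG1_le_primG1 hx0 hxu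
  have hGu := hg1.primG1_pos hu0
  have hgu := hg1.map_pos _ hu0
  have hgle := hg1.monotoneOn hu0 (hu0.trans_le huy) huy
  have hkey := hg1.deriv_pos_mul_mom_le hh ht0 (hg1.mom_sq_le hh ht0 hm hhm)
  have hp := hg1.deriv_mom_pos hh ht0 hm
  have hP := hg1.mom_pos hh ht0 hm
  have hv := (deriv_pos_mom_bounds hg1.differentiable hg1.map_pos hg1.deriv_pos hh ht0 m).1
  have hg2u := hg2.map_pos _ hu0
  have hlog := hH2 _ hu0
  rw [sub_nonneg, div_le_div_iff₀ hg2u hGu] at hlog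
  refine div_pos ?_ (by positivity)
  have hsq : d * (2 * h * g1 (pos g1 h m t) ^ 2) ≤ d * (2 * h * g1 (pos g1 h m y) ^ 2) := by
    gcongr
  have h2d : 0 ≤ 2 - 2 * d := by
    by_contra! hneg
    have h1 : 0 < primG1 g1 (pos g1 h m x) := hg1.primG1_pos hx0
    have h2 : 0 ≤ d * (2 * h * g1 (pos g1 h m y) ^ 2) := by positivity
    nlinarith
  have hGG := mul_le_mul_of_nonneg_left hG h2d
  generalize deriv (pos g1 h m) t = v at *
  generalize deriv (mom g1 h m) t = p at *
  generalize mom g1 h m t = P at *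
  generalize pos g1 h m t = u at *
  have hvP : 0 ≤ v * P := mul_nonneg (by linarith) hP.le
  have e1 := mul_le_mul_of_nonneg_right hlog hvP
  have e2 := mul_le_mul_of_nonneg_left hkey (mul_nonneg hd0 hg2u.le)
  have e3 : (g2 u * p) * (d * (2 * h * g1 u ^ 2)) < (g2 u * p) * ((2 - 2 * d) * primG1 g1 u) :=
    mul_lt_mul_of_pos_left (by linarith) (mul_pos hg2u hp)
  have e4 : 0 < (2 * primG1 g1 u) * (p * g2 u - P * (deriv g2 u * v)) := by linarith
  exact pos_of_mul_pos_right e4 (by positivity)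

/-- A priori bound for the end point of a solution. -/
lemma GG_pos_le {g1 g2 : ℝ → ℝ} (hg1 : IsConvexSource g1) (hg2 : IsConvexSource g2)
    {α : ℝ} {h : ℝ} (hh : 0 < h) {m : ℕ} (hhm : h * m = 1) {x c : ℝ} (hx : 0 < x) (hc : 0 < c)
    (hcu : c ≤ pos g1 h m x) (hle : mom g1 h m x ≤ α * g2 (pos g1 h m x)) :
    GG g1 g2 (pos g1 h m x) ≤ α ^ 2 / 2 + α * (c / g2 c) := by
  have hu0 := (pos_pos_mom_nonneg hg1.map_pos hh hx m).1
  have hP := (pos_pos_mom_nonneg hg1.map_pos hh hx m).2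
  have h1 := energy_lower hg1.map_pos hg1.monotoneOn hg1.primG1_sub_le hh hx m
  have h2 := (mom_bounds hg1.map_pos hg1.monotoneOn hh hx m).1
  rw [hhm, one_mul] at h2
  have h3 := primG1_le_mul hg1.differentiable.continuous hg1.monotoneOn_Ici hx
  have h4 : x ≤ pos g1 h m x := pos_monotone hg1.map_pos hh hx (Nat.zero_le m)
  have h5 := mul_le_mul_of_deriv_mono hg2.differentiable hg2.map_zero hg2.monotoneOn_deriv hc hcu
  have hg2c := hg2.map_pos c hc
  have hg2u := hg2.map_pos _ hu0
  have hgx := hg1.map_pos x hx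
  rw [GG, div_le_iff₀ (by positivity)]
  generalize mom g1 h m x = P at *
  generalize pos g1 h m x = u at *
  have h6 : P ^ 2 ≤ (α * g2 u) ^ 2 := by gcongr
  have h7 : x * g1 x ≤ u * (α * g2 u) := by gcongr; linarith
  have h8 : u ≤ c / g2 c * g2 u := by
    rw [div_mul_eq_mul_div, le_div_iff₀ hg2c]; exact h5
  have h9 : u * (α * g2 u) ≤ c / g2 c * g2 u * (α * g2 u) := by
    have : 0 ≤ α * g2 u := by linarith
    gcongr
  linarith

lemma IsSolution.eq_pos {g1 g2 : ℝ → ℝ} {h α : ℝ} {m : ℕ} (hm : 0 < m) {u : ℕ → ℝ}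
    (hu : IsSolution g1 g2 (m + 1) h α u) : ∀ k ≤ m, u (k + 1) = pos g1 h k (u 1) := by
  obtain ⟨-, h1, h2, -⟩ := hu
  have key : ∀ k < m, u (k + 1) = pos g1 h k (u 1) ∧ u (k + 2) = pos g1 h (k + 1) (u 1) := by
    intro k
    induction k with
    | zero =>
      intro _
      refine ⟨rfl, ?_⟩
      rw [pos_succ, pos_zero, mom_zero]
      simp only [zero_add]
      linarith
    | succ k ih =>
      intro hk
      obtain ⟨ih1, ih2⟩ := ih (by lia)
      refine ⟨ih2, ?_⟩
      have h3 := h2 (k + 2) (by lia) (by lia)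
      rw [show k + 2 - 1 = k + 1 by lia, ih1, ih2] at h3
      have h4 := pos_succ g1 h k (u 1)
      rw [pos_succ g1 h (k + 1), mom_succ]
      rw [show k + 1 + 2 = k + 2 + 1 by lia]
      linear_combination h3 + h4
  intro k hk
  rcases hk.lt_or_eq with hlt | rfl
  · exact (key k hlt).1
  · obtain ⟨j, rfl⟩ := Nat.exists_eq_succ_of_ne_zero hm.ne'
    exact (key j (Nat.lt_succ_self j)).2

lemma IsSolution.mom_eq {g1 g2 : ℝ → ℝ} {h α : ℝ} (hh : 0 < h) {m : ℕ} (hm : 0 < m) {u : ℕ → ℝ}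
    (hu : IsSolution g1 g2 (m + 1) h α u) :
    mom g1 h m (u 1) = α * g2 (pos g1 h m (u 1)) := by
  have hpos := hu.eq_pos hm
  have hend := hu.2.2.2
  obtain ⟨j, rfl⟩ := Nat.exists_eq_succ_of_ne_zero hm.ne'
  rw [Nat.succ_eq_add_one] at *
  rw [show j + 1 + 1 - 1 = j + 1 by lia, hpos (j + 1) le_rfl, hpos j (by lia)] at hend
  apply mul_left_cancel₀ hh.ne'
  rw [mom_succ]
  linear_combination hend - pos_succ g1 h j (u 1)

lemma isSolution_pos {g1 g2 : ℝ → ℝ} (hg1 : ∀ y > 0, 0 < g1 y) {h α : ℝ} (hh : 0 < h)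
    {m : ℕ} (hm : 0 < m) {x : ℝ} (hx : 0 < x)
    (hend : mom g1 h m x = α * g2 (pos g1 h m x)) :
    IsSolution g1 g2 (m + 1) h α fun k => pos g1 h (k - 1) x := by
  refine ⟨fun k _ _ => (pos_pos_mom_nonneg hg1 hh hx _).1, ?_, ?_, ?_⟩
  · simp [pos_succ, pos_zero, mom_zero]
  · intro k hk _
    obtain ⟨j, rfl⟩ := Nat.exists_eq_add_of_le' hk
    simp only [Nat.add_sub_cancel, show j + 2 - 1 = j + 1 by lia, show j + 1 - 1 = j by lia]
    rw [pos_succ g1 h (j + 1), mom_succ]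
    linear_combination - pos_succ g1 h j x
  · obtain ⟨j, rfl⟩ := Nat.exists_eq_succ_of_ne_zero hm.ne'
    rw [Nat.succ_eq_add_one] at *
    simp only [Nat.add_sub_cancel]
    rw [mom_succ] at hend
    linear_combination h * hend + pos_succ g1 h j x

theorem stmt_15
    (g1 g2 : ℝ → ℝ)
    (hg1C : ContDiff ℝ 3 g1) (hg2C : ContDiff ℝ 3 g2)
    (hg10 : g1 0 = 0) (hg20 : g2 0 = 0)
    (hg1d : ∀ x > (0:ℝ), 0 < deriv g1 x) (hg2d : ∀ x > (0:ℝ), 0 < deriv g2 x)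
    (hg1dd : ∀ x > (0:ℝ), 0 < deriv (deriv g1) x)
    (hg2dd : ∀ x > (0:ℝ), 0 < deriv (deriv g2) x)
    (hg1ddd : ∀ x > (0:ℝ), 0 ≤ deriv (deriv (deriv g1)) x)
    (hg2ddd : ∀ x > (0:ℝ), 0 ≤ deriv (deriv (deriv g2)) x)
    (α : ℝ) (hα : 0 < α)
    (hgmono : StrictMonoOn (gg g1 g2) (Set.Ioi 0))
    (hgbij : Set.BijOn (gg g1 g2) (Set.Ioi 0) (Set.Ioi 0))
    (hGmono : StrictMonoOn (GG g1 g2) (Set.Ioi 0))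
    (hGbij : Set.BijOn (GG g1 g2) (Set.Ioi 0) (Set.Ioi 0))
    (d : ℝ) (hd0 : 0 ≤ d) (hd1 : d < 1)
    (hH2 : ∀ x > (0:ℝ), 0 ≤ d * g1 x / primG1 g1 x - 2 * deriv g2 x / g2 x)
    (hH3 : ∀ x > (0:ℝ), 0 ≤ deriv (deriv (GG g1 g2)) x) :
    ∃ M > (0:ℝ), ∀ n : ℕ, 1 + M / (2 - 2 * d) < (n : ℝ) →
      (∃ u : ℕ → ℝ, IsSolution g1 g2 n (1 / ((n : ℝ) - 1)) α u) ∧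
      (∀ u v : ℕ → ℝ, IsSolution g1 g2 n (1 / ((n : ℝ) - 1)) α u →
        IsSolution g1 g2 n (1 / ((n : ℝ) - 1)) α v →
        ∀ k, 1 ≤ k → k ≤ n → u k = v k) := by
  have h1 : IsConvexSource g1 := ⟨hg1C, hg10, hg1d, hg1dd, hg1ddd⟩
  have h2 : IsConvexSource g2 := ⟨hg2C, hg20, hg2d, hg2dd, hg2ddd⟩
  obtain ⟨c, hc, hcα⟩ := hgbij.surjOn (mem_Ioi.2 hα)
  rw [mem_Ioi] at hc
  have hg2c := h2.map_pos c hc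
  obtain ⟨C₁, hC₁, hC₁K⟩ := hGbij.surjOn
    (mem_Ioi.2 (show 0 < α ^ 2 / 2 + α * (c / g2 c) + 1 by positivity))
  set K := α ^ 2 / 2 + α * (c / g2 c)
  set C := max c C₁
  have hcC : c ≤ C := le_max_left _ _
  have hC : 0 < C := hc.trans_le hcC
  have hKC : K < GG g1 g2 C := by
    have := hGmono.monotoneOn hC₁ hC (le_max_right c C₁)
    linarith
  have hGc := h1.primG1_pos hc
  have hgC := h1.map_pos C hC
  refine ⟨2 * g1 C ^ 2 / primG1 g1 c, by positivity, fun n hn => ?_⟩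
  have h2d : 0 < 2 - 2 * d := by linarith
  have hM : 0 < 2 * g1 C ^ 2 / primG1 g1 c / (2 - 2 * d) := by positivity
  have hn1 : (1 : ℝ) < n := by linarith
  obtain ⟨m, rfl⟩ : ∃ m, n = m + 1 := Nat.exists_eq_succ_of_ne_zero (by rintro rfl; norm_num at hn1)
  have hm : 0 < m := by
    have : 1 < m + 1 := by exact_mod_cast hn1
    lia
  have hmR : (0 : ℝ) < m := by exact_mod_cast hm
  rw [show ((m + 1 : ℕ) : ℝ) - 1 = m by push_cast; ring]
  have hh : (0 : ℝ) < 1 / m := by positivity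
  have hhm : (1 / m : ℝ) * m = 1 := by field_simp
  have hsmall : d * (2 * (1 / m : ℝ) * g1 C ^ 2) < (2 - 2 * d) * primG1 g1 c := by
    push_cast at hn
    have e1 : 2 * g1 C ^ 2 / primG1 g1 c / (2 - 2 * d) < m := by linarith
    rw [div_lt_iff₀ h2d, div_lt_iff₀ hGc] at e1
    have e2 : 2 * (1 / m : ℝ) * g1 C ^ 2 < (2 - 2 * d) * primG1 g1 c := by
      calc _ = (1 / m : ℝ) * (2 * g1 C ^ 2) := by ring
        _ < (1 / m : ℝ) * (m * (2 - 2 * d) * primG1 g1 c) := by gcongr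
        _ = _ := by rw [← mul_assoc, ← mul_assoc, hhm, one_mul]
    have e3 : 0 ≤ 2 * (1 / m : ℝ) * g1 C ^ 2 := by positivity
    nlinarith
  generalize (1 / m : ℝ) = h at *
  have hmom_le : ∀ x > 0, mom g1 h m x ≤ g1 (pos g1 h m x) := fun x hx => by
    have := (mom_bounds h1.map_pos h1.monotoneOn hh hx m).2
    rwa [hhm, one_mul] at this
  constructor
  · obtain ⟨x₁, hx₁, hxc⟩ := h1.exists_pos_eq hh m hc
    obtain ⟨x₂, hx₂, hxC⟩ := h1.exists_pos_eq hh m hC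
    obtain ⟨hdu, hdp⟩ := differentiable_pos_mom h1.differentiable h m
    have hcont : Continuous fun x => mom g1 h m x - α * g2 (pos g1 h m x) :=
      hdp.continuous.sub (continuous_const.mul (h2.differentiable.continuous.comp hdu.continuous))
    have hlo : mom g1 h m x₁ - α * g2 (pos g1 h m x₁) ≤ 0 := by
      have := hmom_le x₁ hx₁
      rw [gg, div_eq_iff hg2c.ne'] at hcα
      rw [hxc] at this ⊢
      linarith
    have hhi : 0 ≤ mom g1 h m x₂ - α * g2 (pos g1 h m x₂) := by
      by_contra! hneg
      have := GG_pos_le h1 h2 hh hhm hx₂ hc (hcC.trans_eq hxC.symm) (sub_neg.1 hneg).le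
      rw [hxC] at this
      exact this.not_gt hKC
    obtain ⟨x, hx, hx0⟩ := isPreconnected_Ioi.intermediate_value (mem_Ioi.2 hx₁) (mem_Ioi.2 hx₂)
      hcont.continuousOn ⟨hlo, hhi⟩
    exact ⟨_, isSolution_pos h1.map_pos hh hm hx (sub_eq_zero.1 hx0)⟩
  · have hrange : ∀ x > 0, mom g1 h m x = α * g2 (pos g1 h m x) →
        c ≤ pos g1 h m x ∧ pos g1 h m x ≤ C := fun x hx hx' => by
      have hu := (pos_pos_mom_nonneg h1.map_pos hh hx m).1
      have hcu : c ≤ pos g1 h m x := by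
        rw [← hgmono.le_iff_le hc hu, hcα, gg, le_div_iff₀ (h2.map_pos _ hu), ← hx']
        exact hmom_le x hx
      refine ⟨hcu, ?_⟩
      rw [← hGmono.le_iff_le hu hC]
      exact (GG_pos_le h1 h2 hh hhm hx hc hcu hx'.le).trans hKC.le
    have hnot : ∀ x y, 0 < x → x < y → mom g1 h m x = α * g2 (pos g1 h m x) →
        mom g1 h m y = α * g2 (pos g1 h m y) → False := fun x y hx hxy hxα hyα => by
      have hy := hx.trans hxy
      have hux := (pos_pos_mom_nonneg h1.map_pos hh hx m).1
      have huy := (pos_pos_mom_nonneg h1.map_pos hh hy m).1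
      have hgy := h1.map_pos _ huy
      have hgle := h1.monotoneOn huy hC (hrange y hy hyα).2
      have hGle := h1.primG1_le_primG1 hc (hrange x hx hxα).1
      have hs : d * (2 * h * g1 (pos g1 h m y) ^ 2)
          < (2 - 2 * d) * primG1 g1 (pos g1 h m x) :=
        calc _ ≤ d * (2 * h * g1 C ^ 2) := by gcongr
          _ < _ := hsmall
          _ ≤ _ := by gcongr
      have hlt := strictMonoOn_quotient h1 h2 hd0 hH2 hh hm hhm hx hs
        (left_mem_Icc.2 hxy.le) (right_mem_Icc.2 hxy.le) hxy
      simp only [hxα, hyα, mul_div_cancel_right₀ _ (h2.map_pos _ hux).ne',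
        mul_div_cancel_right₀ _ (h2.map_pos _ huy).ne', lt_irrefl] at hlt
    intro u v hu hv k hk1 hkn
    have hu0 := hu.1 1 le_rfl (by lia)
    have hv0 := hv.1 1 le_rfl (by lia)
    have huv : u 1 = v 1 := by
      rcases lt_trichotomy (u 1) (v 1) with hlt | heq | hlt
      · exact (hnot _ _ hu0 hlt (hu.mom_eq hh hm) (hv.mom_eq hh hm)).elim
      · exact heq
      · exact (hnot _ _ hv0 hlt (hv.mom_eq hh hm) (hu.mom_eq hh hm)).elim
    obtain ⟨j, rfl⟩ := Nat.exists_eq_add_of_le' hk1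
    rw [hu.eq_pos hm j (by lia), hv.eq_pos hm j (by lia), huv]
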